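/- arXiv:1608.08957 — 4 statements merged into one kernel-verified Lean document; each statement's English description precedes it below -/
import Mathlib

section
/- Let G be a finite connected simple graph and let u ∈ (0, 1/2]. Then gon(G) ≥ min{ B_u(G), h(G)·u·|V(G)| }. -/
open SimpleGraph Finset

namespace GraphGonality

variable {V : Type*}

/-- The degree of a divisor: the sum of its values. -/
def degD [Fintype V] (D : V → ℤ) : ℤ := ∑ v, D v

/-- A divisor is effective if it is nonnegative at every vertex. -/
def Effective (D : V → ℤ) : Prop := ∀ v, 0 ≤ D v

/-- The graph Laplacian applied to an integer vector. -/
def lapply (G : SimpleGraph V) [Fintype V] [DecidableEq V] [DecidableRel G.Adj]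
    (x : V → ℤ) : V → ℤ :=
  fun v => (G.degree v : ℤ) * x v - ∑ w ∈ G.neighborFinset v, x w

/-- Two divisors are linearly equivalent if their difference lies in the image of the
Laplacian acting on `ℤ^V`. -/
def LinEquiv (G : SimpleGraph V) [Fintype V] [DecidableEq V] [DecidableRel G.Adj]
    (D D' : V → ℤ) : Prop :=
  ∃ x : V → ℤ, D - D' = lapply G x

/-- A divisor has positive rank if, for every vertex `v`, the divisor `D - 1_v` is
linearly equivalent to an effective divisor. -/
def PosRank (G : SimpleGraph V) [Fintype V] [DecidableEq V] [DecidableRel G.Adj]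
    (D : V → ℤ) : Prop :=
  ∀ v : V, ∃ E : V → ℤ, Effective E ∧
    LinEquiv G (fun w => D w - if w = v then 1 else 0) E

/-- The gonality of a graph: the smallest degree of a divisor of positive rank. -/
noncomputable def gonality (G : SimpleGraph V) [Fintype V] [DecidableEq V]
    [DecidableRel G.Adj] : ℤ :=
  sInf {d : ℤ | ∃ D : V → ℤ, PosRank G D ∧ degD D = d}

/-- The support of a divisor. -/
def suppD (D : V → ℤ) : Set V := {v | 0 < D v}

/-- The edge boundary of a set of vertices: edges with exactly one endpoint in `U`. -/
def edgeBoundary (G : SimpleGraph V) (U : Set V) : Set (Sym2 V) :=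
  {e | e ∈ G.edgeSet ∧ ∃ a b, e = s(a, b) ∧ a ∈ U ∧ b ∉ U}

/-- The Cheeger constant of a graph. -/
noncomputable def cheeger (G : SimpleGraph V) [Fintype V] : ℝ :=
  sInf {r : ℝ | ∃ U : Set V, U.Nonempty ∧ (U.ncard : ℝ) ≤ (Fintype.card V : ℝ) / 2 ∧
    r = (edgeBoundary G U).ncard / U.ncard}

/-- The `u`-Cheeger constant of a graph. -/
noncomputable def cheegerU (G : SimpleGraph V) [Fintype V] (u : ℝ) : ℝ :=
  sInf {r : ℝ | ∃ U : Set V, U.Nonempty ∧ (U.ncard : ℝ) ≤ u * (Fintype.card V : ℝ) ∧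
    r = (edgeBoundary G U).ncard / U.ncard}

/-- Every connected component of the induced subgraph on the complement of the support
of `D` has at most `u * |V|` vertices. -/
def ComponentsSmall (G : SimpleGraph V) [Fintype V] (D : V → ℤ) (u : ℝ) : Prop :=
  ∀ c : (G.induce (suppD D)ᶜ).ConnectedComponent,
    (c.supp.ncard : ℝ) ≤ u * (Fintype.card V : ℝ)

/-- `B_u(G)`: the smallest degree of an effective divisor all of whose complementary
components have size at most `u * |V|`. -/
noncomputable def Bu (G : SimpleGraph V) [Fintype V] (u : ℝ) : ℤ :=
  sInf {d : ℤ | ∃ D : V → ℤ, Effective D ∧ ComponentsSmall G D u ∧ degD D = d}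


/-- The Laplacian as a sum of differences along edges. -/
theorem lapply_eq_sum (G : SimpleGraph V) [Fintype V] [DecidableEq V] [DecidableRel G.Adj]
    (x : V → ℤ) (v : V) : lapply G x v = ∑ w ∈ G.neighborFinset v, (x v - x w) := by
  simp [lapply, Finset.sum_sub_distrib]

theorem lapply_sub (G : SimpleGraph V) [Fintype V] [DecidableEq V] [DecidableRel G.Adj]
    (x y : V → ℤ) : lapply G (x - y) = lapply G x - lapply G y := by
  funext v
  simp only [lapply_eq_sum, Pi.sub_apply, ← Finset.sum_sub_distrib]
  exact Finset.sum_congr rfl fun w _ => by ring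

theorem lapply_add (G : SimpleGraph V) [Fintype V] [DecidableEq V] [DecidableRel G.Adj]
    (x y : V → ℤ) : lapply G (x + y) = lapply G x + lapply G y := by
  rw [← sub_eq_iff_eq_add, ← lapply_sub, add_sub_cancel_right]

theorem degD_lapply (G : SimpleGraph V) [Fintype V] [DecidableEq V] [DecidableRel G.Adj]
    (x : V → ℤ) : degD (lapply G x) = 0 := by
  have h : degD (lapply G x) = ∑ v, ∑ w, if G.Adj v w then x v - x w else 0 := by
    refine Finset.sum_congr rfl fun v _ => ?_
    rw [lapply_eq_sum, ← Finset.sum_filter]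
    exact Finset.sum_congr (by ext; simp) fun _ _ => rfl
  have h' : degD (lapply G x) = -degD (lapply G x) := by
    conv_lhs => rw [h, Finset.sum_comm]
    rw [h, ← Finset.sum_neg_distrib]
    refine Finset.sum_congr rfl fun v _ => ?_
    rw [← Finset.sum_neg_distrib]
    refine Finset.sum_congr rfl fun w _ => ?_
    simp only [G.adj_comm w v]
    split_ifs <;> ring
  omega

theorem LinEquiv.degD_eq {G : SimpleGraph V} [Fintype V] [DecidableEq V] [DecidableRel G.Adj]
    {D D' : V → ℤ} (h : LinEquiv G D D') : degD D = degD D' := by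
  obtain ⟨x, hx⟩ := h
  have h0 := degD_lapply G x
  rw [← hx] at h0
  simp only [degD, Pi.sub_apply, Finset.sum_sub_distrib] at h0 ⊢
  omega

theorem Effective.degD_nonneg [Fintype V] {D : V → ℤ} (h : Effective D) : 0 ≤ degD D :=
  Finset.sum_nonneg fun v _ => h v

/-- The 0-1 indicator vector of a set of vertices. -/
def fireVec (U : Finset V) [DecidableEq V] : V → ℤ := fun v => if v ∈ U then 1 else 0

theorem lapply_fireVec_of_mem (G : SimpleGraph V) [Fintype V] [DecidableEq V]
    [DecidableRel G.Adj] {U : Finset V} {v : V} (hv : v ∈ U) :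
    lapply G (fireVec U) v = #{w ∈ G.neighborFinset v | w ∉ U} := by
  rw [lapply_eq_sum, Finset.card_filter]
  push_cast
  refine Finset.sum_congr rfl fun w _ => ?_
  by_cases hw : w ∈ U <;> simp [fireVec, hv, hw]

theorem lapply_fireVec_of_notMem (G : SimpleGraph V) [Fintype V] [DecidableEq V]
    [DecidableRel G.Adj] {U : Finset V} {v : V} (hv : v ∉ U) :
    lapply G (fireVec U) v = -#{w ∈ G.neighborFinset v | w ∈ U} := by
  rw [lapply_eq_sum, Finset.card_filter]
  push_cast
  rw [← Finset.sum_neg_distrib]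
  refine Finset.sum_congr rfl fun w _ => ?_
  by_cases hw : w ∈ U <;> simp [fireVec, hv, hw]

theorem ncard_edgeBoundary_le_sum (G : SimpleGraph V) [Fintype V] [DecidableEq V]
    [DecidableRel G.Adj] (U : Finset V) :
    (edgeBoundary G U).ncard ≤ ∑ v ∈ U, #{w ∈ G.neighborFinset v | w ∉ U} := by
  rw [← Finset.card_sigma]
  refine le_trans ?_ (Finset.card_image_le (f := fun p : (_ : V) × V => s(p.1, p.2)))
  rw [← Set.ncard_coe_finset]
  refine Set.ncard_le_ncard ?_ (Finset.finite_toSet _)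
  rintro e ⟨he, a, b, rfl, ha, hb⟩
  simp only [Finset.coe_image, Set.mem_image]
  refine ⟨⟨a, b⟩, ?_, rfl⟩
  simpa using ⟨ha, he, hb⟩

/-- If firing `U` keeps an effective divisor effective, its degree bounds `|∂U|`. -/
theorem ncard_edgeBoundary_le_degD (G : SimpleGraph V) [Fintype V] [DecidableEq V]
    [DecidableRel G.Adj] {U : Finset V} {D : V → ℤ} (hD : Effective D)
    (hD' : Effective (D - lapply G (fireVec U))) :
    ((edgeBoundary G U).ncard : ℤ) ≤ degD D := by
  calc ((edgeBoundary G U).ncard : ℤ)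
      ≤ ((∑ v ∈ U, #{w ∈ G.neighborFinset v | w ∉ U} : ℕ) : ℤ) := by
        exact_mod_cast ncard_edgeBoundary_le_sum G U
    _ = ∑ v ∈ U, (#{w ∈ G.neighborFinset v | w ∉ U} : ℤ) := by push_cast; rfl
    _ ≤ ∑ v ∈ U, D v := by
        refine Finset.sum_le_sum fun v hv => ?_
        have := hD' v
        rw [Pi.sub_apply, lapply_fireVec_of_mem G hv] at this
        omega
    _ ≤ degD D :=
        Finset.sum_le_sum_of_subset_of_nonneg (Finset.subset_univ U) fun v _ _ => hD v

/-- Linearly equivalent effective divisors are joined by a chain of effective divisors in which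
each one arises from its predecessor by firing a set, the fired sets being increasing. -/
theorem exists_firing_chain (G : SimpleGraph V) [Fintype V] [DecidableEq V]
    [DecidableRel G.Adj] {D D' : V → ℤ} (hD : Effective D) (hD' : Effective D')
    (h : LinEquiv G D D') :
    ∃ (F : ℕ → V → ℤ) (U : ℕ → Finset V) (K : ℕ),
      F 0 = D ∧ F K = D' ∧ Monotone U ∧
      (∀ k, k ≤ K → Effective (F k)) ∧ (∀ k, LinEquiv G D (F k)) ∧
      ∀ k, F (k + 1) = F k - lapply G (fireVec (U k)) := by
  obtain ⟨x, hx⟩ := h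
  have hx' : ∀ v, D v - D' v = ∑ w ∈ G.neighborFinset v, (x v - x w) := fun v => by
    rw [← lapply_eq_sum, ← hx, Pi.sub_apply]
  set M : ℕ := ∑ v, (x v).natAbs with hM
  have hxM : ∀ v, (x v).natAbs ≤ M := fun v =>
    Finset.single_le_sum (f := fun v => (x v).natAbs) (fun _ _ => Nat.zero_le _)
      (Finset.mem_univ v)
  let y : ℕ → V → ℤ := fun k v => max (x v - M + k) 0
  refine ⟨fun k => D - lapply G (y k), fun k => {v | (M : ℤ) - k ≤ x v}, 2 * M, ?_, ?_, ?_, ?_,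
    ?_, ?_⟩
  · have : y 0 = 0 := by
      funext v
      have := hxM v
      simp only [y, Pi.zero_apply]
      omega
    funext v
    simp [this, lapply]
  · funext v
    have hy : ∀ v, y (2 * M) v = x v + M := fun v => by
      have := hxM v
      simp only [y]
      omega
    simp only [Pi.sub_apply, lapply_eq_sum, hy, add_sub_add_right_eq_sub]
    have := hx' v
    omega
  · intro j k hjk v hv
    simp only [Finset.mem_filter, Finset.mem_univ, true_and] at hv ⊢
    omega
  · intro k _ v
    simp only [Pi.sub_apply, lapply_eq_sum]
    by_cases hv : x v - M + k ≤ 0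
    · have : ∑ w ∈ G.neighborFinset v, (y k v - y k w) ≤ 0 :=
        Finset.sum_nonpos fun w _ => by simp only [y]; omega
      have := hD v
      omega
    · have : ∑ w ∈ G.neighborFinset v, (y k v - y k w) ≤
          ∑ w ∈ G.neighborFinset v, (x v - x w) :=
        Finset.sum_le_sum fun w _ => by simp only [y]; omega
      have := hD' v
      have := hx' v
      omega
  · exact fun k => ⟨y k, by simp⟩
  · intro k
    have : fireVec ({v | (M : ℤ) - k ≤ x v} : Finset V) = y (k + 1) - y k := by
      funext v
      simp only [fireVec, Finset.mem_filter, Finset.mem_univ, true_and, y, Pi.sub_apply]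
      push_cast
      split_ifs <;> omega
    simp only [this, lapply_sub]
    abel

/-- A set of vertices that cannot be cut into two parts without cutting an edge inside it. -/
def Uncuttable (G : SimpleGraph V) (A : Finset V) : Prop :=
  ∀ U : Finset V, (∃ a ∈ A, a ∈ U) → (∃ b ∈ A, b ∉ U) →
    ∃ a ∈ A, a ∈ U ∧ ∃ b ∈ A, b ∉ U ∧ G.Adj a b

/-- The divisor `D` has a chip on `A`. -/
def Hits (D : V → ℤ) (A : Finset V) : Prop := ∃ v ∈ A, 0 < D v

theorem lt_or_lt_of_adj_of_fire {G : SimpleGraph V} [Fintype V] [DecidableEq V]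
    [DecidableRel G.Adj] {U : Finset V} {D D' : V → ℤ} (hD : Effective D) (hD' : Effective D')
    (h : D' = D - lapply G (fireVec U)) {a b : V} (ha : a ∈ U) (hb : b ∉ U) (hab : G.Adj a b) :
    0 < D a ∧ 0 < D' b := by
  have h1 : 0 < #{w ∈ G.neighborFinset a | w ∉ U} :=
    Finset.card_pos.2 ⟨b, by simp [hab, hb]⟩
  have h2 : 0 < #{w ∈ G.neighborFinset b | w ∈ U} :=
    Finset.card_pos.2 ⟨a, by simp [hab.symm, ha]⟩
  have h3 := congrFun h a
  have h4 := congrFun h b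
  rw [Pi.sub_apply, lapply_fireVec_of_mem G ha] at h3
  rw [Pi.sub_apply, lapply_fireVec_of_notMem G hb] at h4
  have := hD' a
  have := hD b
  omega

/-- If firing `U` removes all chips from an uncuttable set, then that set lies inside `U`. -/
theorem Uncuttable.subset_of_hits {G : SimpleGraph V} [Fintype V] [DecidableEq V]
    [DecidableRel G.Adj] {U A : Finset V} {D D' : V → ℤ} (hA : Uncuttable G A)
    (hD : Effective D) (hD' : Effective D') (h : D' = D - lapply G (fireVec U))
    (hit : Hits D A) (hit' : ¬Hits D' A) : A ⊆ U := by
  obtain ⟨v, hv, hvD⟩ := hit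
  have hvU : v ∈ U := by
    by_contra hvU
    refine hit' ⟨v, hv, ?_⟩
    have := congrFun h v
    rw [Pi.sub_apply, lapply_fireVec_of_notMem G hvU] at this
    omega
  intro w hw
  by_contra hwU
  obtain ⟨a, -, haU, b, hb, hbU, hab⟩ := hA U ⟨v, hv, hvU⟩ ⟨w, hw, hwU⟩
  exact hit' ⟨b, hb, (lt_or_lt_of_adj_of_fire hD hD' h haU hbU hab).2⟩

/-- If firing `U` puts the first chips on an uncuttable set, then that set is disjoint from
`U`. -/
theorem Uncuttable.disjoint_of_hits {G : SimpleGraph V} [Fintype V] [DecidableEq V]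
    [DecidableRel G.Adj] {U A : Finset V} {D D' : V → ℤ} (hA : Uncuttable G A)
    (hD : Effective D) (hD' : Effective D') (h : D' = D - lapply G (fireVec U))
    (hit : ¬Hits D A) (hit' : Hits D' A) : Disjoint A U := by
  obtain ⟨v, hv, hvD⟩ := hit'
  have hvU : v ∉ U := by
    intro hvU
    refine hit ⟨v, hv, ?_⟩
    have := congrFun h v
    rw [Pi.sub_apply, lapply_fireVec_of_mem G hvU] at this
    omega
  rw [Finset.disjoint_left]
  intro w hw hwU
  obtain ⟨a, ha, haU, b, -, hbU, hab⟩ := hA U ⟨w, hw, hwU⟩ ⟨v, hv, hvU⟩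
  exact hit ⟨a, ha, (lt_or_lt_of_adj_of_fire hD hD' h haU hbU hab).1⟩

theorem exists_step_of_not_of {P : ℕ → Prop} {K : ℕ} (h0 : ¬P 0) (hK : P K) :
    ∃ i < K, ¬P i ∧ P (i + 1) := by
  induction K with
  | zero => exact absurd hK h0
  | succ n ih =>
    by_cases hn : P n
    · obtain ⟨i, hi, h⟩ := ih hn
      exact ⟨i, by omega, h⟩
    · exact ⟨n, by omega, hn, hK⟩

/-- Scramble argument: a positive-rank divisor class of which no effective representative meets
every member of a family of nonempty uncuttable sets has degree at least the size of some edge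
cut separating two members of the family. -/
theorem exists_cut_of_forall_not_hits (G : SimpleGraph V) [Fintype V] [DecidableEq V]
    [DecidableRel G.Adj] [Nonempty V] (S : Finset (Finset V)) (hS : ∀ A ∈ S, Uncuttable G A)
    (hne : ∀ A ∈ S, A.Nonempty) {D₀ : V → ℤ} (hD₀ : PosRank G D₀)
    (hmiss : ∀ D, Effective D → LinEquiv G D₀ D → ∃ A ∈ S, ¬Hits D A) :
    ∃ U : Finset V, ((edgeBoundary G U).ncard : ℤ) ≤ degD D₀ ∧
      (∃ A ∈ S, A ⊆ U) ∧ ∃ B ∈ S, Disjoint B U := by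
  classical
  have hrep : ∀ v, ∃ D, Effective D ∧ LinEquiv G D₀ D ∧ 0 < D v := by
    intro v
    obtain ⟨E, hE, x, hx⟩ := hD₀ v
    refine ⟨fun w => E w + if w = v then 1 else 0, fun w => ?_, ⟨x, ?_⟩, ?_⟩
    · have := hE w
      dsimp only
      split_ifs <;> omega
    · rw [← hx]
      funext w
      simp only [Pi.sub_apply]
      ring
    · have := hE v
      simp only [if_true]
      omega
  let hitSet : (V → ℤ) → Finset (Finset V) := fun D => {A ∈ S | Hits D A}
  obtain ⟨D, hD, hDe, hmax⟩ : ∃ D, Effective D ∧ LinEquiv G D₀ D ∧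
      ∀ D', Effective D' → LinEquiv G D₀ D' → #(hitSet D') ≤ #(hitSet D) := by
    let T : Set ℕ := {n | ∃ D, Effective D ∧ LinEquiv G D₀ D ∧ #(hitSet D) = n}
    have hTne : T.Nonempty := by
      obtain ⟨D, h1, h2, -⟩ := hrep (Classical.arbitrary V)
      exact ⟨_, D, h1, h2, rfl⟩
    have hTb : BddAbove T := by
      refine ⟨#S, ?_⟩
      rintro n ⟨D, -, -, rfl⟩
      exact Finset.card_filter_le _ _
    obtain ⟨D, h1, h2, h3⟩ := Nat.sSup_mem hTne hTb
    exact ⟨D, h1, h2, fun D' h1' h2' => h3 ▸ le_csSup hTb ⟨D', h1', h2', rfl⟩⟩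
  obtain ⟨B, hBS, hB⟩ := hmiss D hD hDe
  obtain ⟨v, hv⟩ := hne B hBS
  obtain ⟨D', hD', hDe', hvD'⟩ := hrep v
  obtain ⟨x, hx⟩ := hDe
  have hDD' : LinEquiv G D D' := by
    obtain ⟨x', hx'⟩ := hDe'
    exact ⟨x' - x, by rw [lapply_sub, ← hx, ← hx']; abel⟩
  obtain ⟨F, U, K, hF0, hFK, hU, hFeff, hFe, hstep⟩ := exists_firing_chain G hD hD' hDD'
  obtain ⟨i, hiK, hi, hi'⟩ := exists_step_of_not_of (P := fun k => Hits (F k) B)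
    (by rw [hF0]; exact hB) (by rw [hFK]; exact ⟨v, hv, hvD'⟩)
  obtain ⟨A, hAS, hA, hA'⟩ : ∃ A ∈ S, Hits D A ∧ ¬Hits (F (i + 1)) A := by
    by_contra! hcon
    have hlt : #(hitSet D) < #(hitSet (F (i + 1))) := by
      refine Finset.card_lt_card ((Finset.ssubset_iff_of_subset fun A hA => ?_).2 ⟨B, ?_, ?_⟩)
      · obtain ⟨h1, h2⟩ := Finset.mem_filter.1 hA
        exact Finset.mem_filter.2 ⟨h1, hcon A h1 h2⟩
      · exact Finset.mem_filter.2 ⟨hBS, hi'⟩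
      · exact fun h => hB (Finset.mem_filter.1 h).2
    refine absurd (hmax (F (i + 1)) (hFeff _ hiK) ?_) (not_le.2 hlt)
    obtain ⟨z, hz⟩ := hFe (i + 1)
    exact ⟨x + z, by rw [lapply_add, ← hx, ← hz]; abel⟩
  obtain ⟨j, hj, hjA, hjA'⟩ := exists_step_of_not_of (P := fun k => ¬Hits (F k) A)
    (by rw [hF0]; exact not_not.2 hA) hA'
  refine ⟨U i, ?_, ⟨A, hAS, ?_⟩, B, hBS, ?_⟩
  · rw [LinEquiv.degD_eq ⟨x, hx⟩, (hFe i).degD_eq]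
    exact ncard_edgeBoundary_le_degD G (hFeff i hiK.le) (hstep i ▸ hFeff (i + 1) hiK)
  · exact ((hS A hAS).subset_of_hits (hFeff j (by omega)) (hFeff (j + 1) (by omega)) (hstep j)
      (not_not.1 hjA) hjA').trans (hU (by omega))
  · exact (hS B hBS).disjoint_of_hits (hFeff i hiK.le) (hFeff (i + 1) hiK) (hstep i) hi hi'

/-- An effective divisor of degree below `B_u` misses some uncuttable set with more than
`u * |V|` vertices. -/
theorem exists_uncuttable_not_hits (G : SimpleGraph V) [Fintype V] {u : ℝ} {D : V → ℤ}
    (hD : Effective D) (h : degD D < Bu G u) :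
    ∃ A : Finset V, Uncuttable G A ∧ u * (Fintype.card V : ℝ) < #A ∧ ¬Hits D A := by
  classical
  have hns : ¬ComponentsSmall G D u := fun hs => by
    have hle : Bu G u ≤ degD D :=
      csInf_le ⟨0, by rintro d ⟨D, hD, -, rfl⟩; exact hD.degD_nonneg⟩ ⟨D, hD, hs, rfl⟩
    omega
  simp only [ComponentsSmall, not_forall, not_le] at hns
  obtain ⟨c, hc⟩ := hns
  have hmem : ∀ v, v ∈ (Subtype.val '' c.supp).toFinset ↔ ∃ z ∈ c.supp, z.1 = v := fun v => by
    rw [Set.mem_toFinset, Set.mem_image]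
  refine ⟨(Subtype.val '' c.supp).toFinset, ?_, ?_, ?_⟩
  · rintro U ⟨a, ha, haU⟩ ⟨b, hb, hbU⟩
    obtain ⟨a, hac, rfl⟩ := (hmem a).1 ha
    obtain ⟨b, hbc, rfl⟩ := (hmem b).1 hb
    obtain ⟨p⟩ := ConnectedComponent.exact (hac.trans hbc.symm)
    obtain ⟨d, -, hd1, hd2⟩ := p.exists_boundary_dart {z | z ∈ c.supp ∧ z.1 ∈ U} ⟨hac, haU⟩
      fun h => hbU h.2
    have hd3 : d.snd ∈ c.supp := (ConnectedComponent.sound d.adj.symm.reachable).trans hd1.1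
    exact ⟨d.fst.1, (hmem _).2 ⟨_, hd1.1, rfl⟩, hd1.2, d.snd.1, (hmem _).2 ⟨_, hd3, rfl⟩,
      fun h => hd2 ⟨hd3, h⟩, d.adj⟩
  · rwa [← Set.ncard_eq_toFinset_card', Set.ncard_image_of_injective _ Subtype.val_injective]
  · rintro ⟨v, hv, hvD⟩
    obtain ⟨z, -, rfl⟩ := (hmem v).1 hv
    exact z.2 hvD

theorem edgeBoundary_compl (G : SimpleGraph V) (U : Set V) :
    edgeBoundary G Uᶜ = edgeBoundary G U := by
  ext e
  constructor
  · rintro ⟨he, a, b, rfl, ha, hb⟩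
    exact ⟨he, b, a, Sym2.eq_swap, not_not.1 hb, ha⟩
  · rintro ⟨he, a, b, rfl, ha, hb⟩
    exact ⟨he, b, a, Sym2.eq_swap, hb, not_not.2 ha⟩

theorem cheeger_nonneg (G : SimpleGraph V) [Fintype V] : 0 ≤ cheeger G :=
  Real.sInf_nonneg (by rintro r ⟨U, -, -, rfl⟩; positivity)

theorem cheeger_mul_ncard_le (G : SimpleGraph V) [Fintype V] {U : Set V}
    (hU : (U.ncard : ℝ) ≤ (Fintype.card V : ℝ) / 2) :
    cheeger G * U.ncard ≤ (edgeBoundary G U).ncard := by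
  rcases U.eq_empty_or_nonempty with rfl | hne
  · simp
  · have hpos : (0 : ℝ) < U.ncard := by exact_mod_cast hne.ncard_pos
    rw [← le_div_iff₀ hpos]
    exact csInf_le ⟨0, by rintro r ⟨U, -, -, rfl⟩; positivity⟩ ⟨U, hne, hU, rfl⟩

theorem cheeger_mul_le_ncard_edgeBoundary (G : SimpleGraph V) [Fintype V] {U : Set V} {t : ℝ}
    (hU : t ≤ U.ncard) (hUc : t ≤ Uᶜ.ncard) : cheeger G * t ≤ (edgeBoundary G U).ncard := by
  have hsum : (U.ncard : ℝ) + Uᶜ.ncard = Fintype.card V := by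
    exact_mod_cast (Set.ncard_add_ncard_compl U).trans Nat.card_eq_fintype_card
  rcases le_total (U.ncard : ℝ) ((Fintype.card V : ℝ) / 2) with h | h
  · exact (mul_le_mul_of_nonneg_left hU (cheeger_nonneg G)).trans (cheeger_mul_ncard_le G h)
  · rw [← edgeBoundary_compl]
    exact (mul_le_mul_of_nonneg_left hUc (cheeger_nonneg G)).trans
      (cheeger_mul_ncard_le G (by linarith))

/-- The gonality is attained. -/
theorem exists_posRank_degD_eq_gonality (G : SimpleGraph V) [Fintype V] [DecidableEq V]
    [DecidableRel G.Adj] [Nonempty V] : ∃ D, PosRank G D ∧ degD D = gonality G := by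
  refine Int.csInf_mem (s := {d : ℤ | ∃ D : V → ℤ, PosRank G D ∧ degD D = d})
    ⟨_, fun _ => 1, fun v => ⟨fun w => 1 - if w = v then 1 else 0, fun w => ?_, 0, ?_⟩, rfl⟩
    ⟨0, ?_⟩
  · dsimp only
    split_ifs <;> simp
  · funext w
    simp [lapply]
  · rintro d ⟨D, hD, rfl⟩
    obtain ⟨E, hE, hDE⟩ := hD (Classical.arbitrary V)
    have h1 := hE.degD_nonneg
    rw [← hDE.degD_eq] at h1
    simp only [degD, Finset.sum_sub_distrib, Finset.sum_ite_eq', Finset.mem_univ, if_true] at h1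
    simp only [degD]
    omega

/-- Theorem 1 (Lower bound): for a finite connected simple graph `G` and `u ∈ (0, 1/2]`,
`gon(G) ≥ min { B_u(G), h(G) · u · |V(G)| }`. -/
theorem gonality_ge_min_Bu_cheeger {V : Type*} [Fintype V] [DecidableEq V]
    (G : SimpleGraph V) [DecidableRel G.Adj] (hG : G.Connected)
    (u : ℝ) (hu0 : 0 < u) (hu : u ≤ 1 / 2) :
    min ((Bu G u : ℝ)) (cheeger G * (u * (Fintype.card V : ℝ))) ≤ (gonality G : ℝ) := by
  classical
  have := hG.nonempty
  obtain ⟨D₀, hD₀, hdeg⟩ := exists_posRank_degD_eq_gonality G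
  rw [min_le_iff]
  by_cases hBu : Bu G u ≤ gonality G
  · exact Or.inl (by exact_mod_cast hBu)
  right
  obtain ⟨U, hcut, ⟨A, hA, hAU⟩, B, hB, hBU⟩ := exists_cut_of_forall_not_hits G
    {A : Finset V | Uncuttable G A ∧ u * (Fintype.card V : ℝ) < #A}
    (fun A hA => (Finset.mem_filter.1 hA).2.1)
    (fun A hA => by
      have h : (0 : ℝ) < #A :=
        lt_of_le_of_lt (by positivity) (Finset.mem_filter.1 hA).2.2
      exact Finset.card_pos.1 (by exact_mod_cast h))
    hD₀ (fun D hD hDe => by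
      obtain ⟨A, h1, h2, h3⟩ := exists_uncuttable_not_hits G (u := u) hD
        (by rw [← hDe.degD_eq, hdeg]; exact not_le.1 hBu)
      exact ⟨A, Finset.mem_filter.2 ⟨Finset.mem_univ _, h1, h2⟩, h3⟩)
  have hA' : u * (Fintype.card V : ℝ) ≤ (U : Set V).ncard := by
    rw [Set.ncard_coe_finset]
    exact (Finset.mem_filter.1 hA).2.2.le.trans (by exact_mod_cast Finset.card_le_card hAU)
  have hB' : u * (Fintype.card V : ℝ) ≤ ((U : Set V)ᶜ).ncard := by
    rw [← Finset.coe_compl, Set.ncard_coe_finset]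
    refine (Finset.mem_filter.1 hB).2.2.le.trans ?_
    exact_mod_cast Finset.card_le_card fun v hv =>
      Finset.mem_compl.2 (Finset.disjoint_left.1 hBU hv)
  refine (cheeger_mul_le_ncard_edgeBoundary G hA' hB').trans ?_
  rw [← hdeg]
  exact_mod_cast hcut

end GraphGonality
end

section
/- Let G be a finite connected simple graph that is k-regular, let u ∈ (0, 1/2], and let D be an effective divisor on G with deg(D) < (h_u(G)/(k + h_u(G)))·|V(G)|. Then there exists a connected component of the induced subgraph on V(G) ∖ supp(D) with more than u·|V(G)| vertices. -/
open SimpleGraph Finset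

namespace GraphGonality

variable {V : Type*}

/-- The defining inequality of the `u`-Cheeger constant. -/
theorem cheegerU_mul_ncard_le (G : SimpleGraph V) [Fintype V] {u : ℝ} {U : Set V}
    (hU : U.Nonempty) (hUu : (U.ncard : ℝ) ≤ u * (Fintype.card V : ℝ)) :
    cheegerU G u * U.ncard ≤ (edgeBoundary G U).ncard := by
  have hpos : (0 : ℝ) < U.ncard := by
    exact_mod_cast (Set.ncard_pos (Set.toFinite U)).2 hU
  rw [← le_div_iff₀ hpos]
  refine csInf_le ⟨0, ?_⟩ ⟨U, hU, hUu, rfl⟩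
  rintro r ⟨W, -, -, rfl⟩
  positivity

theorem cheegerU_nonneg (G : SimpleGraph V) [Fintype V] (u : ℝ) : 0 ≤ cheegerU G u := by
  refine Real.sInf_nonneg ?_
  rintro r ⟨W, -, -, rfl⟩
  positivity

/-- The support of an effective divisor has at most `deg D` elements. -/
theorem ncard_suppD_le_degD [Fintype V] {D : V → ℤ} (hD : Effective D) :
    ((suppD D).ncard : ℤ) ≤ degD D := by
  classical
  have hcard : (suppD D).ncard = #{v | 0 < D v} := by
    rw [← Set.ncard_coe_finset]
    simp [suppD]
  rw [hcard, Finset.card_filter, degD, Nat.cast_sum]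
  refine Finset.sum_le_sum fun v _ => ?_
  have := hD v
  split_ifs <;> push_cast <;> omega

/-- The components of an induced subgraph partition its vertex set. -/
theorem sum_ncard_supp_connectedComponent {W : Type*} [Finite W] (H : SimpleGraph W)
    [Fintype H.ConnectedComponent] :
    ∑ c : H.ConnectedComponent, c.supp.ncard = Nat.card W := by
  classical
  have := Fintype.ofFinite W
  rw [Nat.card_eq_fintype_card, ← Finset.card_univ,
    Finset.card_eq_sum_card_fiberwise (f := H.connectedComponentMk) (t := Finset.univ)
      (fun _ _ => Finset.mem_coe.2 (Finset.mem_univ _))]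
  refine Finset.sum_congr rfl fun c _ => ?_
  rw [← Set.ncard_coe_finset]
  congr 1
  ext v
  simp

/-- An edge leaving a component of the complement of `S` ends in `S`. -/
theorem edgeBoundary_connectedComponent_subset (G : SimpleGraph V) (S : Set V)
    (c : (G.induce Sᶜ).ConnectedComponent) :
    edgeBoundary G (Subtype.val '' c.supp) ⊆
      (fun p : V × V => s(p.1, p.2)) ''
        {p | p.1 ∈ Subtype.val '' c.supp ∧ p.2 ∈ S ∧ G.Adj p.1 p.2} := by
  rintro e ⟨he, a, b, rfl, ha, hb⟩
  refine ⟨(a, b), ⟨ha, ?_, he⟩, rfl⟩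
  by_contra hbS
  obtain ⟨a, hac, rfl⟩ := ha
  have hadj : (G.induce Sᶜ).Adj a ⟨b, hbS⟩ := he
  exact hb ⟨⟨b, hbS⟩, (c.mem_supp_congr_adj hadj).1 hac, rfl⟩

/-- In a `k`-regular graph, the boundaries of the components of the complement of `S`
have at most `k * |S|` edges in total. -/
theorem sum_ncard_edgeBoundary_le [Fintype V] (G : SimpleGraph V) [DecidableRel G.Adj]
    {k : ℕ} (hreg : G.IsRegularOfDegree k) (S : Set V)
    [Fintype (G.induce Sᶜ).ConnectedComponent] :
    ∑ c : (G.induce Sᶜ).ConnectedComponent,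
      (edgeBoundary G (Subtype.val '' c.supp)).ncard ≤ k * S.ncard := by
  classical
  let P (c : (G.induce Sᶜ).ConnectedComponent) : Finset (V × V) :=
    {p | p.1 ∈ Subtype.val '' c.supp ∧ p.2 ∈ S ∧ G.Adj p.1 p.2}
  have hP : ∀ c, (edgeBoundary G (Subtype.val '' c.supp)).ncard ≤ #(P c) := fun c => by
    refine (Set.ncard_le_ncard (edgeBoundary_connectedComponent_subset G S c)
      (Set.toFinite _)).trans ((Set.ncard_image_le (Set.toFinite _)).trans ?_)
    rw [← Set.ncard_coe_finset]
    simp [P]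
  have hdisj : (Set.univ : Set (G.induce Sᶜ).ConnectedComponent).PairwiseDisjoint P := by
    intro c _ d _ hcd
    refine Finset.disjoint_left.2 fun p hpc hpd => hcd ?_
    obtain ⟨⟨x, hx, hxp⟩, -⟩ := (Finset.mem_filter.1 hpc).2
    obtain ⟨⟨y, hy, hyp⟩, -⟩ := (Finset.mem_filter.1 hpd).2
    obtain rfl : x = y := Subtype.ext (hxp.trans hyp.symm)
    exact hx.symm.trans hy
  calc ∑ c, (edgeBoundary G (Subtype.val '' c.supp)).ncard
      ≤ ∑ c, #(P c) := Finset.sum_le_sum fun c _ => hP c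
    _ = #(Finset.univ.biUnion P) :=
        (Finset.card_biUnion fun c _ d _ hcd => hdisj trivial trivial hcd).symm
    _ ≤ #(S.toFinset.biUnion fun v => (G.neighborFinset v).image fun w => (w, v)) := by
        refine Finset.card_le_card fun p hp => ?_
        obtain ⟨c, -, hc⟩ := Finset.mem_biUnion.1 hp
        obtain ⟨-, hS, hadj⟩ := (Finset.mem_filter.1 hc).2
        exact Finset.mem_biUnion.2 ⟨p.2, Set.mem_toFinset.2 hS,
          Finset.mem_image.2 ⟨p.1, (G.mem_neighborFinset _ _).2 hadj.symm, rfl⟩⟩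
    _ ≤ #S.toFinset * k := Finset.card_biUnion_le_card_mul _ _ _ fun v _ =>
        Finset.card_image_le.trans (hreg v).le
    _ = k * S.ncard := by rw [Set.ncard_eq_toFinset_card', mul_comm]

/-- Lemma (components of the complement of a small divisor): if `G` is `k`-regular and `D`
is an effective divisor of degree less than `(h_u(G)/(k + h_u(G))) |V(G)|`, then some
connected component of the induced subgraph on `V(G) ∖ supp(D)` has more than
`u |V(G)|` vertices. -/
theorem exists_large_component {V : Type*} [Fintype V] [DecidableEq V]
    (G : SimpleGraph V) [DecidableRel G.Adj] (hG : G.Connected)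
    (k : ℕ) (hreg : G.IsRegularOfDegree k) (u : ℝ) (hu0 : 0 < u) (hu : u ≤ 1 / 2)
    (D : V → ℤ) (hD : Effective D)
    (hdeg : (degD D : ℝ) <
      cheegerU G u / ((k : ℝ) + cheegerU G u) * (Fintype.card V : ℝ)) :
    ∃ c : (G.induce (suppD D)ᶜ).ConnectedComponent,
      u * (Fintype.card V : ℝ) < (c.supp.ncard : ℝ) := by
  classical
  by_contra! hsmall
  have := Fintype.ofFinite (G.induce (suppD D)ᶜ).ConnectedComponent
  have hnn := cheegerU_nonneg G u
  have hS : ((suppD D).ncard : ℝ) ≤ degD D := by exact_mod_cast ncard_suppD_le_degD hD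
  have hcheeger : ∀ c : (G.induce (suppD D)ᶜ).ConnectedComponent,
      cheegerU G u * c.supp.ncard ≤ (edgeBoundary G (Subtype.val '' c.supp)).ncard := by
    intro c
    have hcard : (Subtype.val '' c.supp : Set V).ncard = c.supp.ncard :=
      Set.ncard_image_of_injective _ Subtype.val_injective
    rw [← hcard]
    exact cheegerU_mul_ncard_le G (c.nonempty_supp.image _) (hcard ▸ hsmall c)
  have hcompl : ((suppD D).ncard : ℝ) + Nat.card ↥(suppD D)ᶜ = Fintype.card V := by
    rw [← Nat.card_eq_fintype_card]
    exact_mod_cast Set.ncard_add_ncard_compl (suppD D)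
  have hbound : cheegerU G u * Nat.card ↥(suppD D)ᶜ ≤ k * (suppD D).ncard := by
    rw [← sum_ncard_supp_connectedComponent (G.induce (suppD D)ᶜ), Nat.cast_sum,
      Finset.mul_sum]
    refine (Finset.sum_le_sum fun c _ => hcheeger c).trans ?_
    exact_mod_cast sum_ncard_edgeBoundary_le G hreg (suppD D)
  have hdenom : 0 ≤ (k : ℝ) + cheegerU G u := by positivity
  rcases hdenom.eq_or_lt with h0 | hpos
  · rw [← h0, div_zero, zero_mul] at hdeg
    exact absurd hdeg (not_lt.2 ((Nat.cast_nonneg _).trans hS))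
  · rw [div_mul_eq_mul_div, lt_div_iff₀ hpos, ← hcompl] at hdeg
    have := mul_le_mul_of_nonneg_right hS hdenom
    linarith

end GraphGonality
end

section
/- Let G be a finite connected simple graph with at least one edge, and let α(G) denote its independence number. Then gon(G) ≤ |V(G)| − α(G). -/
open SimpleGraph Finset

namespace GraphGonality

variable {V : Type*}

/-- A set of vertices is independent if no two of its vertices are adjacent. -/
def IndepSet (G : SimpleGraph V) (S : Set V) : Prop := ∀ a ∈ S, ∀ b ∈ S, ¬ G.Adj a b

/-- The independence number: the largest size of an independent set of vertices. -/
noncomputable def indepNum (G : SimpleGraph V) [Fintype V] : ℕ :=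
  sSup {n : ℕ | ∃ S : Set V, IndepSet G S ∧ S.ncard = n}

theorem sum_lapply (G : SimpleGraph V) [Fintype V] [DecidableEq V] [DecidableRel G.Adj]
    (x : V → ℤ) : ∑ v, lapply G x v = 0 := by
  have h : ∑ v, ∑ w ∈ G.neighborFinset v, x w = ∑ w, ∑ v ∈ G.neighborFinset w, x w :=
    Finset.sum_comm' (by simp [G.adj_comm])
  simp [lapply, Finset.sum_sub_distrib, h]

theorem PosRank.degD_pos {G : SimpleGraph V} [Fintype V] [DecidableEq V] [DecidableRel G.Adj]
    [Nonempty V] {D : V → ℤ} (hD : PosRank G D) : 0 < degD D := by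
  obtain ⟨E, hE, x, hx⟩ := hD (Classical.arbitrary V)
  have hsum := sum_lapply G x
  rw [← hx] at hsum
  simp only [Pi.sub_apply, Finset.sum_sub_distrib, Finset.sum_ite_eq', Finset.mem_univ,
    if_true] at hsum
  have hE' : 0 ≤ ∑ v, E v := Finset.sum_nonneg fun v _ => hE v
  unfold degD
  linarith

theorem gonality_le_degD {G : SimpleGraph V} [Fintype V] [DecidableEq V] [DecidableRel G.Adj]
    [Nonempty V] {D : V → ℤ} (hD : PosRank G D) : gonality G ≤ degD D := by
  refine csInf_le ⟨0, ?_⟩ ⟨D, hD, rfl⟩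
  rintro _ ⟨D', hD', rfl⟩
  exact hD'.degD_pos.le

theorem exists_indepSet_ncard_eq_indepNum (G : SimpleGraph V) [Fintype V] :
    ∃ S : Set V, IndepSet G S ∧ S.ncard = indepNum G := by
  refine Nat.sSup_mem (s := {n : ℕ | ∃ S : Set V, IndepSet G S ∧ S.ncard = n})
    ⟨0, ∅, by simp [IndepSet], by simp⟩ ⟨Nat.card V, ?_⟩
  rintro _ ⟨S, -, rfl⟩
  exact Set.ncard_le_card S

/-- Firing every vertex except `v` moves one chip from each neighbour of `v` to `v`, so the
indicator of the complement of an independent set has positive rank. -/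
theorem IndepSet.posRank_indicator_compl {G : SimpleGraph V} [Fintype V] [DecidableEq V]
    [DecidableRel G.Adj] {S : Set V} (hS : IndepSet G S) (hdeg : ∀ v, 0 < G.degree v) :
    PosRank G (Sᶜ.indicator 1) := by
  classical
  intro v
  by_cases hv : v ∈ S
  · refine ⟨_, ?_, -Pi.single v 1, sub_sub_cancel _ _⟩
    intro w
    by_cases hw : w = v
    · subst hw
      have := hdeg w
      simp [lapply, Pi.single_apply, hv]
      lia
    · by_cases hadj : G.Adj w v
      · have hwS : w ∉ S := fun h => hS w h v hv hadj
        simp [lapply, Pi.single_apply, hw, hadj, hwS]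
      · simp [lapply, Pi.single_apply, hw, hadj, Set.indicator_apply]
        split_ifs <;> simp
  · refine ⟨_, ?_, 0, (sub_self _).trans (by ext; simp [lapply])⟩
    intro w
    by_cases hw : w = v
    · simp [hw, hv]
    · simp only [hw, if_false, sub_zero]
      exact Set.indicator_nonneg (fun _ _ => zero_le_one) w

theorem degD_indicator_compl [Fintype V] (S : Set V) :
    degD (Sᶜ.indicator 1) = (Fintype.card V : ℤ) - (S.ncard : ℤ) := by
  classical
  have h := Set.ncard_add_ncard_compl S
  rw [Nat.card_eq_fintype_card] at h
  have h' : degD (Sᶜ.indicator 1) = (Sᶜ.ncard : ℤ) := by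
    rw [Set.ncard_eq_toFinset_card', ← Set.filter_mem_univ_eq_toFinset]
    simp [degD, Set.indicator_apply, Finset.sum_ite]
  lia

/-- For a finite connected simple graph `G` with at least one edge,
`gon(G) ≤ |V(G)| − α(G)` where `α(G)` is the independence number. -/
theorem gonality_le_card_sub_indepNum {V : Type*} [Fintype V] [DecidableEq V]
    (G : SimpleGraph V) [DecidableRel G.Adj] (hG : G.Connected)
    (he : G.edgeSet.Nonempty) :
    gonality G ≤ (Fintype.card V : ℤ) - (indepNum G : ℤ) := by
  obtain ⟨S, hS, hcard⟩ := exists_indepSet_ncard_eq_indepNum G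
  obtain ⟨e, he⟩ := he
  have : Nontrivial V := by
    induction e with
    | _ a b => exact ⟨a, b, G.ne_of_adj he⟩
  rw [← hcard, ← degD_indicator_compl]
  exact gonality_le_degD (hS.posRank_indicator_compl fun v =>
    hG.preconnected.degree_pos_of_nontrivial v)

end GraphGonality
end

section
/- Let G be a finite connected simple graph with at least one edge, and let S ⊆ V(G) be an independent set (no two vertices of S are adjacent). Then the divisor D with D(v) = 1 for v ∈ V(G) ∖ S and D(v) = 0 for v ∈ S has positive rank. -/
open SimpleGraph Finset

namespace GraphGonality

variable {V : Type*}

/-- The divisor that places one chip on every vertex outside an independent set `S`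
(and none on `S`) has positive rank. -/
theorem complement_of_indepSet_posRank {V : Type*} [Fintype V] [DecidableEq V]
    (G : SimpleGraph V) [DecidableRel G.Adj] (hG : G.Connected)
    (he : G.edgeSet.Nonempty) (S : Set V) [DecidablePred (· ∈ S)]
    (hS : IndepSet G S) :
    PosRank G (fun v => if v ∈ S then 0 else 1) := by
  intro v
  by_cases hv : v ∈ S
  · let x : V → ℤ := fun w => if w = v then -1 else 0
    refine ⟨(fun w => (if w ∈ S then 0 else 1) - if w = v then 1 else 0) - lapply G x,
      fun w => ?_, x, sub_sub_cancel _ _⟩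
    have : Nontrivial V := by
      obtain ⟨e, he⟩ := he
      induction e with | _ a b => exact ⟨a, b, G.ne_of_adj he⟩
    have hdeg : 0 < G.degree v := hG.preconnected.degree_pos_of_nontrivial v
    by_cases hwv : w = v
    · subst hwv
      simp [lapply, x, hv]
      omega
    · by_cases hadj : G.Adj w v
      · have hw : w ∉ S := fun hw => hS w hw v hv hadj
        simp [lapply, x, hwv, hadj, hw]
      · simp [lapply, x, hwv, hadj]
        split_ifs <;> simp
  · refine ⟨fun w => (if w ∈ S then 0 else 1) - if w = v then 1 else 0, fun w => ?_, 0, ?_⟩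
    · by_cases hwv : w = v
      · simp [hwv, hv]
      · simp only [hwv, if_false]
        split_ifs <;> simp
    · ext w
      simp [lapply]

end GraphGonality
end
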